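/- arXiv:1308.3005 — 10 statements merged into one kernel-verified Lean document; each statement's English description precedes it below -/
import Mathlib

section
/- Let 0 ≤ a ≤ 1/2 and b > 0, and define f(x,y) = (1/2 - a)·(cos(π y / b) - cos(π (x - a y / b))) - a·cos(π (x + (1-2a) y /(2b)))·cos(π y /(2b)). Then the Lebesgue integral of f over T(a,b) equals 0. -/
open Real MeasureTheory

lemma tri_interior (a b : ℝ) (hb : 0 < b) :
    interior (convexHull ℝ {((0 : ℝ), (0 : ℝ)), (1, 0), (a, b)}) =
      {p : ℝ × ℝ | 0 < p.2 ∧ a * p.2 / b < p.1 ∧ p.1 < 1 - (1 - a) * p.2 / b} := by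
  apply Set.Subset.antisymm
  · have hC : convexHull ℝ {((0 : ℝ), (0 : ℝ)), (1, 0), (a, b)} ⊆
        {p : ℝ × ℝ | 0 ≤ p.2 ∧ a * p.2 ≤ b * p.1 ∧ b * p.1 + (1 - a) * p.2 ≤ b} := by
      apply convexHull_min
      · intro p hp
        simp only [Set.mem_insert_iff, Set.mem_singleton_iff] at hp
        rcases hp with rfl | rfl | rfl <;> simp only [Set.mem_ofPred_eq] <;>
          refine ⟨?_, ?_, ?_⟩ <;> nlinarith
      · intro p hp q hq s t hs ht hst
        obtain ⟨h1, h2, h3⟩ := hp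
        obtain ⟨g1, g2, g3⟩ := hq
        simp only [Set.mem_ofPred_eq, Prod.fst_add, Prod.snd_add, Prod.smul_fst, Prod.smul_snd,
          smul_eq_mul]
        have e1 := mul_le_mul_of_nonneg_left h1 hs
        have e2 := mul_le_mul_of_nonneg_left h2 hs
        have e3 := mul_le_mul_of_nonneg_left h3 hs
        have k1 := mul_le_mul_of_nonneg_left g1 ht
        have k2 := mul_le_mul_of_nonneg_left g2 ht
        have k3 := mul_le_mul_of_nonneg_left g3 ht
        have : s * b + t * b = b := by rw [← add_mul, hst, one_mul]
        refine ⟨by linarith, by linarith, by linarith⟩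
    intro p hp
    have key : ∀ v : ℝ × ℝ, ∃ t : ℝ, 0 < t ∧
        p + t • v ∈ {p : ℝ × ℝ | 0 ≤ p.2 ∧ a * p.2 ≤ b * p.1 ∧ b * p.1 + (1 - a) * p.2 ≤ b} := by
      intro v
      have hc : Filter.Tendsto (fun t : ℝ => p + t • v) (nhdsWithin 0 (Set.Ioi 0)) (nhds p) := by
        have : Continuous (fun t : ℝ => p + t • v) := by fun_prop
        have h := this.tendsto 0
        simp only [zero_smul, add_zero] at h
        exact h.mono_left nhdsWithin_le_nhds
      have h2 := hc.eventually (mem_interior_iff_mem_nhds.1 hp)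
      obtain ⟨t, ht, ht'⟩ := (h2.and self_mem_nhdsWithin).exists
      exact ⟨t, ht', hC ht⟩
    obtain ⟨t1, ht1, h1, -, -⟩ := key (0, -1)
    obtain ⟨t2, ht2, -, h2, -⟩ := key (-1, 0)
    obtain ⟨t3, ht3, -, -, h3⟩ := key (1, 0)
    simp only [Prod.fst_add, Prod.snd_add, Prod.smul_fst, Prod.smul_snd, smul_eq_mul] at h1 h2 h3
    have := mul_pos hb ht2
    have := mul_pos hb ht3
    refine ⟨by linarith, ?_, ?_⟩
    · rw [div_lt_iff₀ hb]; linarith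
    · rw [lt_sub_iff_add_lt, ← lt_sub_iff_add_lt', div_lt_iff₀ hb]; linarith
  · apply interior_maximal
    · rintro ⟨x, y⟩ ⟨h1, h2, h3⟩
      simp only at h1 h2 h3
      rw [mul_div_assoc] at h2 h3
      have ht : 0 < y / b := div_pos h1 hb
      have m0 : ((0 : ℝ), (0 : ℝ)) ∈ convexHull ℝ {((0 : ℝ), (0 : ℝ)), (1, 0), (a, b)} :=
        subset_convexHull ℝ _ (by simp)
      have m1 : ((1 : ℝ), (0 : ℝ)) ∈ convexHull ℝ {((0 : ℝ), (0 : ℝ)), (1, 0), (a, b)} :=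
        subset_convexHull ℝ _ (by simp)
      have m2 : (a, b) ∈ convexHull ℝ {((0 : ℝ), (0 : ℝ)), (1, 0), (a, b)} :=
        subset_convexHull ℝ _ (by simp)
      have hs : 0 < 1 - y / b := by linarith
      have m3 := (convex_convexHull ℝ {((0 : ℝ), (0 : ℝ)), (1, 0), (a, b)}) m0 m1
        (a := 1 - (x - a * (y / b)) / (1 - y / b)) (b := (x - a * (y / b)) / (1 - y / b))
        (by rw [sub_nonneg, div_le_one hs]; linarith) (div_nonneg (by linarith) hs.le) (by ring)
      have m4 := (convex_convexHull ℝ {((0 : ℝ), (0 : ℝ)), (1, 0), (a, b)}) m3 m2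
        (a := 1 - y / b) (b := y / b) hs.le ht.le (by ring)
      convert m4 using 1
      ext
      · simp only [Prod.fst_add, Prod.smul_fst, smul_eq_mul, mul_zero, zero_add, mul_one]
        rw [mul_div_cancel₀ _ hs.ne']
        ring
      · simp only [Prod.snd_add, Prod.smul_snd, smul_eq_mul, mul_zero, zero_add]
        rw [div_mul_cancel₀ _ hb.ne']
    · refine IsOpen.and ?_ (IsOpen.and ?_ ?_)
      · exact isOpen_lt (by fun_prop) (by fun_prop)
      · exact isOpen_lt (by fun_prop) (by fun_prop)
      · exact isOpen_lt (by fun_prop) (by fun_prop)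

lemma inner_int (a t : ℝ) :
    ∫ x in (a * t)..(1 - (1 - a) * t),
      ((1 / 2 - a) * (Real.cos (π * t) - Real.cos (π * (x - a * t)))
        - a * Real.cos (π * (x + (1 - 2 * a) * t / 2)) * Real.cos (π * t / 2)) =
     (1 / 2 - a) * ((1 - t) * cos (π * t) - sin (π * t) / π) := by
  have hpi := Real.pi_ne_zero
  have hd : ∀ x ∈ Set.uIcc (a * t) (1 - (1 - a) * t), HasDerivAt
      (fun x => (1 / 2 - a) * (x * Real.cos (π * t) - Real.sin (π * (x - a * t)) / π)
        - a * (Real.sin (π * (x + (1 - 2 * a) * t / 2)) / π) * Real.cos (π * t / 2))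
      ((1 / 2 - a) * (Real.cos (π * t) - Real.cos (π * (x - a * t)))
        - a * Real.cos (π * (x + (1 - 2 * a) * t / 2)) * Real.cos (π * t / 2)) x := by
    intro x _
    have i := hasDerivAt_id' x
    have s1 := (((i.sub_const (a * t)).const_mul π).sin.div_const π)
    have s2 := (((i.add_const ((1 - 2 * a) * t / 2)).const_mul π).sin.div_const π)
    refine ((((i.mul_const (cos (π * t))).sub s1).const_mul (1 / 2 - a)).sub
      ((s2.const_mul a).mul_const (cos (π * t / 2)))).congr_deriv ?_
    field_simp
  rw [intervalIntegral.integral_eq_sub_of_hasDerivAt hd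
    (Continuous.intervalIntegrable (by fun_prop) _ _)]
  have e1 : π * (1 - (1 - a) * t - a * t) = π - π * t := by ring
  have e2 : π * (1 - (1 - a) * t + (1 - 2 * a) * t / 2) = π - π * t / 2 := by ring
  have e3 : π * (a * t + (1 - 2 * a) * t / 2) = π * t / 2 := by ring
  have e4 : π * (a * t - a * t) = 0 := by ring
  rw [e1, e2, e3, e4, Real.sin_pi_sub, Real.sin_pi_sub, Real.sin_zero]
  ring

lemma outer_int (a b : ℝ) (hb : 0 < b) :
    ∫ y in (0:ℝ)..b, (1 / 2 - a) * ((1 - y / b) * cos (π * (y / b)) - sin (π * (y / b)) / π) = 0 := by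
  have hpi := Real.pi_ne_zero
  have hd : ∀ y ∈ Set.uIcc 0 b, HasDerivAt
      (fun y => b * (1 / 2 - a) * ((1 - y / b) * (sin (π * (y / b)) / π)))
      ((1 / 2 - a) * ((1 - y / b) * cos (π * (y / b)) - sin (π * (y / b)) / π)) y := by
    intro y _
    have i := (hasDerivAt_id' y).div_const b
    refine (((i.const_sub 1).mul ((i.const_mul π).sin.div_const π)).const_mul (b * (1 / 2 - a))).congr_deriv ?_
    field_simp
    ring
  rw [intervalIntegral.integral_eq_sub_of_hasDerivAt hd
    (Continuous.intervalIntegrable (by fun_prop) _ _)]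
  simp [hb.ne']

theorem stmt_2 (a b : ℝ) (ha0 : 0 ≤ a) (ha : a ≤ 1 / 2) (hb : 0 < b)
    (T : Set (ℝ × ℝ)) (hT : T = interior (convexHull ℝ {((0 : ℝ), (0 : ℝ)), (1, 0), (a, b)}))
    (f : ℝ → ℝ → ℝ)
    (hf : ∀ x y, f x y =
      (1 / 2 - a) * (Real.cos (π * y / b) - Real.cos (π * (x - a * y / b)))
        - a * Real.cos (π * (x + (1 - 2 * a) * y / (2 * b))) * Real.cos (π * y / (2 * b))) :
    ∫ p in T, f p.1 p.2 = 0 := by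
  have hTm : MeasurableSet T := by rw [hT]; exact isOpen_interior.measurableSet
  have hfc : Continuous (fun p : ℝ × ℝ => f p.1 p.2) := by
    simp only [hf]; fun_prop
  have hK : IsCompact (convexHull ℝ {((0 : ℝ), (0 : ℝ)), (1, 0), (a, b)}) :=
    Set.Finite.isCompact_convexHull ℝ (s := {((0 : ℝ), (0 : ℝ)), (1, 0), (a, b)}) (by simp)
  have hint : IntegrableOn (fun p : ℝ × ℝ => f p.1 p.2) T := by
    refine (hfc.continuousOn.integrableOn_compact hK).mono_set ?_
    rw [hT]; exact interior_subset
  rw [tri_interior a b hb] at hT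
  rw [← integral_indicator hTm]
  rw [← integrable_indicator_iff hTm] at hint
  rw [Measure.volume_eq_prod] at hint ⊢
  rw [integral_prod_symm _ hint]
  have hin : ∀ y, ∫ x, T.indicator (fun p : ℝ × ℝ => f p.1 p.2) (x, y) =
      (Set.Ioc 0 b).indicator (fun y => (1 / 2 - a) *
        ((1 - y / b) * cos (π * (y / b)) - sin (π * (y / b)) / π)) y := by
    intro y
    by_cases hy : y ∈ Set.Ioc 0 b
    · rw [Set.indicator_of_mem hy, ← inner_int a (y / b)]
      have hle : a * (y / b) ≤ 1 - (1 - a) * (y / b) := by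
        have : y / b ≤ 1 := (div_le_one hb).2 hy.2
        linarith
      rw [intervalIntegral.integral_of_le hle, integral_Ioc_eq_integral_Ioo,
        ← integral_indicator measurableSet_Ioo]
      congr 1
      ext x
      have hmem : (x, y) ∈ T ↔ x ∈ Set.Ioo (a * (y / b)) (1 - (1 - a) * (y / b)) := by
        rw [hT]
        simp [hy.1, mul_div_assoc]
      by_cases hx : (x, y) ∈ T
      · rw [Set.indicator_of_mem hx, Set.indicator_of_mem (hmem.1 hx), hf]
        have e1 : π * (y / b) = π * y / b := by ring
        have e2 : a * (y / b) = a * y / b := by ring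
        have e3 : (1 - 2 * a) * (y / b) / 2 = (1 - 2 * a) * y / (2 * b) := by field_simp
        have e4 : π * y / b / 2 = π * y / (2 * b) := by field_simp
        rw [e1, e2, e3, e4]
      · rw [Set.indicator_of_notMem hx, Set.indicator_of_notMem (fun h => hx (hmem.2 h))]
    · rw [Set.indicator_of_notMem hy]
      have : ∀ x, T.indicator (fun p : ℝ × ℝ => f p.1 p.2) (x, y) = 0 := by
        intro x
        apply Set.indicator_of_notMem
        intro h
        rw [hT] at h
        obtain ⟨h1, h2, h3⟩ := h
        simp only at h1 h2 h3
        apply hy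
        refine ⟨h1, ?_⟩
        rw [mul_div_assoc] at h2 h3
        have : y / b < 1 := by linarith
        exact ((div_lt_one hb).1 this).le
      simp [this]
  simp only [hin]
  rw [integral_indicator measurableSet_Ioc, ← intervalIntegral.integral_of_le hb.le]
  exact outer_int a b hb
end

section
/- Let 0 ≤ a ≤ 1/2 and b > 0, set c := a(a-1), and define f(x,y) = (1/2 - a)·(cos(π y / b) - cos(π (x - a y / b))) - a·cos(π (x + (1-2a) y /(2b)))·cos(π y /(2b)). Then ∫_{T(a,b)} |∇f|² dA = [ (π²(2c(2 + b² + c) + b² + 1) - 16c(b² + c)) / (2(3c+1)b²) ] · ∫_{T(a,b)} f² dA. -/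
open Real MeasureTheory

/-- The closed triangle described by inequalities. -/
lemma tri_hull (a b : ℝ) (hb : 0 < b) :
    convexHull ℝ {((0 : ℝ), (0 : ℝ)), (1, 0), (a, b)}
      = {p : ℝ × ℝ | p.2 ∈ Set.Icc 0 b ∧
          p.1 ∈ Set.Icc (a * (p.2 / b)) (1 - p.2 / b + a * (p.2 / b))} := by
  apply Set.Subset.antisymm
  · apply convexHull_min
    · rintro p (rfl | rfl | rfl) <;> simp [hb.le, hb.ne']
    · rintro ⟨x, y⟩ ⟨⟨h1, h2⟩, h3, h4⟩ ⟨x', y'⟩ ⟨⟨h1', h2'⟩, h3', h4'⟩ s t hs ht hst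
      simp only [Prod.smul_mk, smul_eq_mul, Prod.mk_add_mk, Set.mem_ofPred_eq, Set.mem_Icc,
        add_div, mul_div_assoc] at *
      obtain rfl : t = 1 - s := by linarith
      refine ⟨⟨by positivity, ?_⟩, ?_, ?_⟩
      · nlinarith
      · nlinarith [mul_le_mul_of_nonneg_left h3 hs, mul_le_mul_of_nonneg_left h3' ht]
      · nlinarith [mul_le_mul_of_nonneg_left h4 hs, mul_le_mul_of_nonneg_left h4' ht]
  · rintro ⟨x, y⟩ ⟨⟨h1, h2⟩, h3, h4⟩
    simp only at h1 h2 h3 h4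
    set t := y / b with ht
    have hy : y = t * b := by rw [ht]; field_simp
    have ht0 : 0 ≤ t := by positivity
    have key := (convex_convexHull ℝ {((0 : ℝ), (0 : ℝ)), (1, 0), (a, b)}).sum_mem
      (t := Finset.univ) (w := ![1 - (x - a * t) - t, x - a * t, t])
      (z := ![((0 : ℝ), (0 : ℝ)), (1, 0), (a, b)])
      (by
        intro i _
        fin_cases i <;> simp <;> linarith)
      (by simp [Fin.sum_univ_three]; ring)
      (by
        intro i _
        apply subset_convexHull
        fin_cases i <;> simp)
    have e : (x, y) = ∑ i : Fin 3, (![1 - (x - a * t) - t, x - a * t, t] i) •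
      (![((0 : ℝ), (0 : ℝ)), (1, 0), (a, b)] i) := by
      simp [Fin.sum_univ_three, hy]
      ring
    rw [e]; exact key

/-- Reduction of the integral over the triangle to an iterated integral. -/
lemma tri_integral (a b : ℝ) (hb : 0 < b) (F : ℝ × ℝ → ℝ) (hF : Continuous F) :
    ∫ p in interior (convexHull ℝ {((0 : ℝ), (0 : ℝ)), (1, 0), (a, b)}), F p
      = b * ∫ t in (0 : ℝ)..1, ∫ u in (0 : ℝ)..(1 - t), F (u + a * t, b * t) := by
  have hcomp : IsCompact (convexHull ℝ {((0 : ℝ), (0 : ℝ)), (1, 0), (a, b)}) :=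
    Set.Finite.isCompact_convexHull ℝ (Set.toFinite _)
  have hae : interior (convexHull ℝ {((0 : ℝ), (0 : ℝ)), (1, 0), (a, b)})
      =ᵐ[volume] convexHull ℝ {((0 : ℝ), (0 : ℝ)), (1, 0), (a, b)} :=
    interior_ae_eq_of_null_frontier
      ((convex_convexHull ℝ _).addHaar_frontier _)
  rw [setIntegral_congr_set hae]
  have hint := (hF.continuousOn (s := convexHull ℝ {((0 : ℝ), (0 : ℝ)), (1, 0), (a, b)})).integrableOn_compact
    (μ := volume) hcomp
  have hmeas := hcomp.measurableSet
  rw [← integrable_indicator_iff hmeas] at hint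
  rw [← integral_indicator hmeas]
  rw [Measure.volume_eq_prod] at hint ⊢
  rw [integral_prod_symm _ hint, tri_hull a b hb]
  have inner : ∀ y : ℝ, (∫ x : ℝ, Set.indicator {p : ℝ × ℝ | p.2 ∈ Set.Icc 0 b ∧
          p.1 ∈ Set.Icc (a * (p.2 / b)) (1 - p.2 / b + a * (p.2 / b))} F (x, y))
      = Set.indicator (Set.Icc 0 b)
        (fun y => ∫ u in (0 : ℝ)..(1 - y / b), F (u + a * (y / b), b * (y / b))) y := by
    intro y
    by_cases hy : y ∈ Set.Icc 0 b
    · rw [Set.indicator_of_mem hy]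
      have h1 : ∀ x : ℝ, Set.indicator {p : ℝ × ℝ | p.2 ∈ Set.Icc 0 b ∧
          p.1 ∈ Set.Icc (a * (p.2 / b)) (1 - p.2 / b + a * (p.2 / b))} F (x, y)
          = Set.indicator (Set.Icc (a * (y / b)) (1 - y / b + a * (y / b))) (fun x => F (x, y)) x := by
        intro x
        simp only [Set.indicator, Set.mem_ofPred_eq, hy, true_and]
      simp_rw [h1]
      rw [integral_indicator measurableSet_Icc, integral_Icc_eq_integral_Ioc,
        ← intervalIntegral.integral_of_le]
      · rw [intervalIntegral.integral_comp_add_right (fun x => F (x, b * (y / b)))]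
        rw [mul_div_cancel₀ _ hb.ne', zero_add]
      · have : y / b ≤ 1 := (div_le_one hb).2 hy.2
        linarith
    · rw [Set.indicator_of_notMem hy]
      have h1 : ∀ x : ℝ, Set.indicator {p : ℝ × ℝ | p.2 ∈ Set.Icc 0 b ∧
          p.1 ∈ Set.Icc (a * (p.2 / b)) (1 - p.2 / b + a * (p.2 / b))} F (x, y) = 0 := by
        intro x
        apply Set.indicator_of_notMem
        exact fun h => hy h.1
      simp_rw [h1]
      exact integral_zero _ _
  simp_rw [inner]
  rw [integral_indicator measurableSet_Icc, integral_Icc_eq_integral_Ioc,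
    ← intervalIntegral.integral_of_le hb.le]
  rw [intervalIntegral.integral_comp_div
    (fun t => ∫ u in (0 : ℝ)..(1 - t), F (u + a * t, b * t)) hb.ne']
  simp [hb.ne']

lemma hd_sin (k m x : ℝ) : HasDerivAt (fun u => sin (π * (k * u + m))) (π * k * cos (π * (k * x + m))) x := by
  have := ((((hasDerivAt_id x).const_mul k).add_const m).const_mul π).sin
  refine this.congr_deriv ?_
  simp only [id]; ring

lemma hd_cos (k m x : ℝ) : HasDerivAt (fun u => cos (π * (k * u + m))) (-(π * k * sin (π * (k * x + m)))) x := by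
  have := ((((hasDerivAt_id x).const_mul k).add_const m).const_mul π).cos
  refine this.congr_deriv ?_
  simp only [id]; ring

lemma sin_quad (e1 e2 e3 e4 e5 e6 : ℝ) :
    ∫ t in (0 : ℝ)..1, ∫ u in (0 : ℝ)..(1 - t),
      (e1 * sin (π * t) ^ 2 + e2 * sin (π * u) ^ 2 + e3 * sin (π * (u + t)) ^ 2
       + e4 * (sin (π * t) * sin (π * u)) + e5 * (sin (π * t) * sin (π * (u + t)))
       + e6 * (sin (π * u) * sin (π * (u + t))))
    = (e1 + e2 + e3) / 4 + 2 / π ^ 2 * (e4 + e5 + e6) := by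
  have hpi := Real.pi_ne_zero
  have inner : ∀ t : ℝ, (∫ u in (0 : ℝ)..(1 - t),
      (e1 * sin (π * t) ^ 2 + e2 * sin (π * u) ^ 2 + e3 * sin (π * (u + t)) ^ 2
       + e4 * (sin (π * t) * sin (π * u)) + e5 * (sin (π * t) * sin (π * (u + t)))
       + e6 * (sin (π * u) * sin (π * (u + t)))))
     = e1 * ((1 - t) * sin (π * t) ^ 2)
       + (e2 + e3) * ((1 - t) / 2 + sin (π * t) * cos (π * t) / (2 * π))
       + (e4 + e5) * (sin (π * t) * (cos (π * t) + 1) / π)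
       + e6 * ((1 - t) / 2 * cos (π * t) + sin (π * t) / (2 * π)) := by
    intro t
    rw [intervalIntegral.integral_eq_sub_of_hasDerivAt
      (f := fun u => e1 * sin (π * t) ^ 2 * u
        + e2 * (u / 2 - sin (π * (1 * u + 0)) * cos (π * (1 * u + 0)) / (2 * π))
        + e3 * (u / 2 - sin (π * (1 * u + t)) * cos (π * (1 * u + t)) / (2 * π))
        + e4 * (-(sin (π * t) * cos (π * (1 * u + 0)) / π))
        + e5 * (-(sin (π * t) * cos (π * (1 * u + t)) / π))
        + e6 * (u / 2 * cos (π * t) - sin (π * (2 * u + t)) / (4 * π)))]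
    · have h1 : π * (1 * (1 - t) + 0) = π - π * t := by ring
      have h2 : π * (1 * (1 - t) + t) = π := by ring
      have h3 : π * (2 * (1 - t) + t) = 2 * π - π * t := by ring
      simp only [h1, h2, h3, Real.sin_pi_sub, Real.cos_pi_sub, Real.sin_pi, Real.cos_pi,
        Real.sin_two_pi_sub, mul_zero, zero_add, Real.sin_zero, Real.cos_zero]
      field_simp
      ring
    · intro u _
      have hs := hd_sin 1 0 u
      have hc := hd_cos 1 0 u
      have hs' := hd_sin 1 t u
      have hc' := hd_cos 1 t u
      have hs2 := hd_sin 2 t u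
      have hid := hasDerivAt_id u
      have := ((((((hid.const_mul (e1 * sin (π * t) ^ 2)).add
        (((hid.div_const 2).sub ((hs.mul hc).div_const (2 * π))).const_mul e2)).add
        (((hid.div_const 2).sub ((hs'.mul hc').div_const (2 * π))).const_mul e3)).add
        ((((hc.const_mul (sin (π * t))).div_const π).neg).const_mul e4)).add
        ((((hc'.const_mul (sin (π * t))).div_const π).neg).const_mul e5)).add
        ((((hid.div_const 2).mul_const (cos (π * t))).sub (hs2.div_const (4 * π))).const_mul e6))
      refine this.congr_deriv (Eq.symm ?_)
      have e1' : π * (2 * u + t) = π * u + π * (u + t) := by ring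
      have e2' : π * t = π * (u + t) - π * u := by ring
      have e3' : cos (π * t) = cos (π * (u + t)) * cos (π * u) + sin (π * (u + t)) * sin (π * u) := by
        rw [← Real.cos_sub]; congr 1
      rw [e1', Real.cos_add, e3']
      simp only [one_mul, add_zero, mul_one]
      have s1 := Real.sin_sq_add_cos_sq (π * u)
      have s2 := Real.sin_sq_add_cos_sq (π * (u + t))
      field_simp
      linear_combination (4 * e2) * s1 + (4 * e3) * s2
    · exact Continuous.intervalIntegrable (by fun_prop) _ _
  simp_rw [inner]
  rw [intervalIntegral.integral_eq_sub_of_hasDerivAt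
    (f := fun t => e1 * ((t - t ^ 2 / 2) / 2 - (1 - t) * (sin (π * (1 * t + 0)) * cos (π * (1 * t + 0))) / (2 * π)
          - sin (π * (1 * t + 0)) ^ 2 / (4 * π ^ 2))
      + (e2 + e3) * ((t - t ^ 2 / 2) / 2 + sin (π * (1 * t + 0)) ^ 2 / (4 * π ^ 2))
      + (e4 + e5) * (sin (π * (1 * t + 0)) ^ 2 / (2 * π ^ 2) - cos (π * (1 * t + 0)) / π ^ 2)
      + e6 * ((1 - t) * sin (π * (1 * t + 0)) / (2 * π) - cos (π * (1 * t + 0)) / π ^ 2))]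
  · simp
    field_simp
    ring
  · intro t _
    have hs := hd_sin 1 0 t
    have hc := hd_cos 1 0 t
    have hid : HasDerivAt (fun t : ℝ => t) 1 t := hasDerivAt_id t
    have hp := (hid.sub ((hid.pow 2).div_const 2)).div_const 2
    have hm := hid.const_sub 1
    have := ((((hp.sub ((hm.mul (hs.mul hc)).div_const (2 * π))).sub
          ((hs.pow 2).div_const (4 * π ^ 2))).const_mul e1).add
      ((hp.add ((hs.pow 2).div_const (4 * π ^ 2))).const_mul (e2 + e3))).add
      ((((hs.pow 2).div_const (2 * π ^ 2)).sub (hc.div_const (π ^ 2))).const_mul (e4 + e5)) |>.add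
      ((((hm.mul hs).div_const (2 * π)).sub (hc.div_const (π ^ 2))).const_mul e6)
    refine this.congr_deriv (Eq.symm ?_)
    have s1 := Real.sin_sq_add_cos_sq (π * t)
    simp only [one_mul, add_zero, mul_one, Pi.mul_apply]
    field_simp
    push_cast
    rw [mul_comm π t] at s1
    ring_nf
    ring_nf at s1
    linear_combination (8 * e1 * π * (1 - t)) * s1
  · exact Continuous.intervalIntegrable (by fun_prop) _ _

lemma cos_quad (e1 e2 e3 e4 e5 e6 : ℝ) :
    ∫ t in (0 : ℝ)..1, ∫ u in (0 : ℝ)..(1 - t),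
      (e1 * cos (π * t) ^ 2 + e2 * cos (π * u) ^ 2 + e3 * cos (π * (u + t)) ^ 2
       + e4 * (cos (π * t) * cos (π * u)) + e5 * (cos (π * t) * cos (π * (u + t)))
       + e6 * (cos (π * u) * cos (π * (u + t))))
    = (e1 + e2 + e3) / 4 := by
  have hpi := Real.pi_ne_zero
  have inner : ∀ t : ℝ, (∫ u in (0 : ℝ)..(1 - t),
      (e1 * cos (π * t) ^ 2 + e2 * cos (π * u) ^ 2 + e3 * cos (π * (u + t)) ^ 2
       + e4 * (cos (π * t) * cos (π * u)) + e5 * (cos (π * t) * cos (π * (u + t)))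
       + e6 * (cos (π * u) * cos (π * (u + t)))))
     = e1 * ((1 - t) * cos (π * t) ^ 2)
       + (e2 + e3) * ((1 - t) / 2 - sin (π * t) * cos (π * t) / (2 * π))
       + (e4 - e5) * (sin (π * t) * cos (π * t) / π)
       + e6 * ((1 - t) / 2 * cos (π * t) - sin (π * t) / (2 * π)) := by
    intro t
    rw [intervalIntegral.integral_eq_sub_of_hasDerivAt
      (f := fun u => e1 * cos (π * t) ^ 2 * u
        + e2 * (u / 2 + sin (π * (1 * u + 0)) * cos (π * (1 * u + 0)) / (2 * π))
        + e3 * (u / 2 + sin (π * (1 * u + t)) * cos (π * (1 * u + t)) / (2 * π))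
        + e4 * (cos (π * t) * sin (π * (1 * u + 0)) / π)
        + e5 * (cos (π * t) * sin (π * (1 * u + t)) / π)
        + e6 * (u / 2 * cos (π * t) + sin (π * (2 * u + t)) / (4 * π)))]
    · have h1 : π * (1 * (1 - t) + 0) = π - π * t := by ring
      have h2 : π * (1 * (1 - t) + t) = π := by ring
      have h3 : π * (2 * (1 - t) + t) = 2 * π - π * t := by ring
      simp only [h1, h2, h3, Real.sin_pi_sub, Real.cos_pi_sub, Real.sin_pi, Real.cos_pi,
        Real.sin_two_pi_sub, mul_zero, zero_add, Real.sin_zero, Real.cos_zero]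
      field_simp
      ring
    · intro u _
      have hs := hd_sin 1 0 u
      have hc := hd_cos 1 0 u
      have hs' := hd_sin 1 t u
      have hc' := hd_cos 1 t u
      have hs2 := hd_sin 2 t u
      have hid := hasDerivAt_id u
      have := ((((((hid.const_mul (e1 * cos (π * t) ^ 2)).add
        (((hid.div_const 2).add ((hs.mul hc).div_const (2 * π))).const_mul e2)).add
        (((hid.div_const 2).add ((hs'.mul hc').div_const (2 * π))).const_mul e3)).add
        (((hs.const_mul (cos (π * t))).div_const π).const_mul e4)).add
        (((hs'.const_mul (cos (π * t))).div_const π).const_mul e5)).add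
        ((((hid.div_const 2).mul_const (cos (π * t))).add (hs2.div_const (4 * π))).const_mul e6))
      refine this.congr_deriv (Eq.symm ?_)
      have e1' : π * (2 * u + t) = π * u + π * (u + t) := by ring
      have e2' : π * t = π * (u + t) - π * u := by ring
      have e3' : cos (π * t) = cos (π * (u + t)) * cos (π * u) + sin (π * (u + t)) * sin (π * u) := by
        rw [← Real.cos_sub]; congr 1
      rw [e1', Real.cos_add, e3']
      simp only [one_mul, add_zero, mul_one]
      have s1 := Real.sin_sq_add_cos_sq (π * u)
      have s2 := Real.sin_sq_add_cos_sq (π * (u + t))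
      field_simp
      linear_combination (4 * e2) * s1 + (4 * e3) * s2
    · exact Continuous.intervalIntegrable (by fun_prop) _ _
  simp_rw [inner]
  rw [intervalIntegral.integral_eq_sub_of_hasDerivAt
    (f := fun t => e1 * ((t - t ^ 2 / 2) / 2 + (1 - t) * (sin (π * (1 * t + 0)) * cos (π * (1 * t + 0))) / (2 * π)
          + sin (π * (1 * t + 0)) ^ 2 / (4 * π ^ 2))
      + (e2 + e3) * ((t - t ^ 2 / 2) / 2 - sin (π * (1 * t + 0)) ^ 2 / (4 * π ^ 2))
      + (e4 - e5) * (sin (π * (1 * t + 0)) ^ 2 / (2 * π ^ 2))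
      + e6 * ((1 - t) * sin (π * (1 * t + 0)) / (2 * π)))]
  · simp
    field_simp
    ring
  · intro t _
    have hs := hd_sin 1 0 t
    have hc := hd_cos 1 0 t
    have hid : HasDerivAt (fun t : ℝ => t) 1 t := hasDerivAt_id t
    have hp := (hid.sub ((hid.pow 2).div_const 2)).div_const 2
    have hm := hid.const_sub 1
    have := ((((hp.add ((hm.mul (hs.mul hc)).div_const (2 * π))).add
          ((hs.pow 2).div_const (4 * π ^ 2))).const_mul e1).add
      ((hp.sub ((hs.pow 2).div_const (4 * π ^ 2))).const_mul (e2 + e3))).add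
      (((hs.pow 2).div_const (2 * π ^ 2)).const_mul (e4 - e5)) |>.add
      (((hm.mul hs).div_const (2 * π)).const_mul e6)
    refine this.congr_deriv (Eq.symm ?_)
    have s1 := Real.sin_sq_add_cos_sq (π * t)
    simp only [one_mul, add_zero, mul_one, Pi.mul_apply]
    field_simp
    push_cast
    rw [mul_comm π t] at s1
    ring_nf
    ring_nf at s1
    linear_combination (8 * e1 * π * (1 - t)) * s1
  · exact Continuous.intervalIntegrable (by fun_prop) _ _

theorem stmt_3 (a b : ℝ) (ha0 : 0 ≤ a) (ha : a ≤ 1 / 2) (hb : 0 < b)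
    (c : ℝ) (hc : c = a * (a - 1))
    (T : Set (ℝ × ℝ)) (hT : T = interior (convexHull ℝ {((0 : ℝ), (0 : ℝ)), (1, 0), (a, b)}))
    (f : ℝ → ℝ → ℝ)
    (hf : ∀ x y, f x y =
      (1 / 2 - a) * (Real.cos (π * y / b) - Real.cos (π * (x - a * y / b)))
        - a * Real.cos (π * (x + (1 - 2 * a) * y / (2 * b))) * Real.cos (π * y / (2 * b))) :
    ∫ p in T, ((deriv (fun x => f x p.2) p.1) ^ 2 + (deriv (fun y => f p.1 y) p.2) ^ 2)
      = (π ^ 2 * (2 * c * (2 + b ^ 2 + c) + b ^ 2 + 1) - 16 * c * (b ^ 2 + c))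
          / (2 * (3 * c + 1) * b ^ 2)
        * ∫ p in T, (f p.1 p.2) ^ 2 := by
  have hpi := Real.pi_ne_zero
  have hb' := hb.ne'
  have hf2 : ∀ x y, f x y = (1 - 2 * a) / 2 * cos (π * (y / b))
      - (1 - a) / 2 * cos (π * (x - a * (y / b))) - a / 2 * cos (π * (x + (1 - a) * (y / b))) := by
    intro x y
    have h1 : π * (x - a * (y / b)) = π * (x + (1 - 2 * a) * y / (2 * b)) - π * y / (2 * b) := by
      field_simp; ring
    have h2 : π * (x + (1 - a) * (y / b))
        = π * (x + (1 - 2 * a) * y / (2 * b)) + π * y / (2 * b) := by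
      field_simp; ring
    have h3 : π * (x - a * y / b) = π * (x - a * (y / b)) := by ring
    have h4 : π * y / b = π * (y / b) := by ring
    rw [hf, h3, h4, h2, h1, Real.cos_add, Real.cos_sub]
    ring
  have hdx : ∀ x y, deriv (fun x => f x y) x =
      π * ((1 - a) / 2 * sin (π * (x - a * (y / b))) + a / 2 * sin (π * (x + (1 - a) * (y / b)))) := by
    intro x y
    have e : (fun x => f x y) = fun x => (1 - 2 * a) / 2 * cos (π * (y / b))
      - (1 - a) / 2 * cos (π * (1 * x + -(a * (y / b))))
      - a / 2 * cos (π * (1 * x + (1 - a) * (y / b))) := by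
      funext x; rw [hf2]; simp only [one_mul, ← sub_eq_add_neg]
    rw [e]
    have := ((((hd_cos 1 (-(a * (y / b))) x).const_mul ((1 - a) / 2)).const_sub
      ((1 - 2 * a) / 2 * cos (π * (y / b)))).sub
      ((hd_cos 1 ((1 - a) * (y / b)) x).const_mul (a / 2))).deriv
    refine Eq.trans this ?_
    simp only [one_mul, ← sub_eq_add_neg]
    ring
  have hdy : ∀ x y, deriv (fun y => f x y) y =
      π / b * (-((1 - 2 * a) / 2 * sin (π * (y / b)))
        - a * ((1 - a) / 2 * sin (π * (x - a * (y / b))))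
        + (1 - a) * (a / 2 * sin (π * (x + (1 - a) * (y / b))))) := by
    intro x y
    have g1 : ∀ y, π * (y / b) = π * (1 / b * y + 0) := by intro y; ring
    have g2 : ∀ y, π * (x - a * (y / b)) = π * (-(a / b) * y + x) := by intro y; ring
    have g3 : ∀ y, π * (x + (1 - a) * (y / b)) = π * ((1 - a) / b * y + x) := by intro y; ring
    have e : (fun y => f x y) = fun y => (1 - 2 * a) / 2 * cos (π * (1 / b * y + 0))
      - (1 - a) / 2 * cos (π * (-(a / b) * y + x))
      - a / 2 * cos (π * ((1 - a) / b * y + x)) := by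
      funext y; rw [hf2, g1, g2, g3]
    rw [e, g1, g2, g3]
    have := ((((hd_cos (1 / b) 0 y).const_mul ((1 - 2 * a) / 2)).sub
      ((hd_cos (-(a / b)) x y).const_mul ((1 - a) / 2))).sub
      ((hd_cos ((1 - a) / b) x y).const_mul (a / 2))).deriv
    refine Eq.trans this ?_
    ring
  simp_rw [hdx, hdy, hf2]
  rw [hT, tri_integral a b hb _ (by fun_prop), tri_integral a b hb _ (by fun_prop)]
  have k1 : ∀ t : ℝ, b * t / b = t := fun t => by field_simp
  have k2 : ∀ u t : ℝ, u + a * t - a * t = u := fun u t => by ring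
  have k3 : ∀ u t : ℝ, u + a * t + (1 - a) * t = u + t := fun u t => by ring
  simp only [k1, k2, k3]
  have I1 := cos_quad (((1 - 2 * a) / 2) ^ 2) (((1 - a) / 2) ^ 2) ((a / 2) ^ 2)
    (-2 * ((1 - 2 * a) / 2) * ((1 - a) / 2)) (-2 * ((1 - 2 * a) / 2) * (a / 2))
    (2 * ((1 - a) / 2) * (a / 2))
  have I2 := sin_quad ((π / b) ^ 2 * ((1 - 2 * a) / 2) ^ 2)
    (π ^ 2 * ((1 - a) / 2) ^ 2 + (π / b) ^ 2 * (a * ((1 - a) / 2)) ^ 2)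
    (π ^ 2 * (a / 2) ^ 2 + (π / b) ^ 2 * ((1 - a) * (a / 2)) ^ 2)
    ((π / b) ^ 2 * (2 * ((1 - 2 * a) / 2) * (a * ((1 - a) / 2))))
    ((π / b) ^ 2 * (-2 * ((1 - 2 * a) / 2) * ((1 - a) * (a / 2))))
    (π ^ 2 * (2 * ((1 - a) / 2) * (a / 2)) - (π / b) ^ 2 * (2 * (a * ((1 - a) / 2)) * ((1 - a) * (a / 2))))
  have J1 : (∫ t in (0 : ℝ)..1, ∫ u in (0 : ℝ)..(1 - t), ((1 - 2 * a) / 2 * cos (π * t)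
      - (1 - a) / 2 * cos (π * u) - a / 2 * cos (π * (u + t))) ^ 2) = _ :=
    Eq.trans (by congr 1; funext t; congr 1; funext u; ring) I1
  have J2 : (∫ t in (0 : ℝ)..1, ∫ u in (0 : ℝ)..(1 - t),
      ((π * ((1 - a) / 2 * sin (π * u) + a / 2 * sin (π * (u + t)))) ^ 2
      + (π / b * (-((1 - 2 * a) / 2 * sin (π * t)) - a * ((1 - a) / 2 * sin (π * u))
        + (1 - a) * (a / 2 * sin (π * (u + t))))) ^ 2)) = _ :=
    Eq.trans (by congr 1; funext t; congr 1; funext u; ring) I2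
  rw [J1, J2]
  have hc1 : 3 * c + 1 ≠ 0 := by
    rw [hc]; nlinarith [sq_nonneg (a - 1 / 2)]
  have hs : (((1 - 2 * a) / 2) ^ 2 + ((1 - a) / 2) ^ 2 + (a / 2) ^ 2) / 4 = (3 * c + 1) / 8 := by
    rw [hc]; ring
  rw [hs]
  generalize 3 * c + 1 = d at hc1
  field_simp
  rw [hc]
  ring
end

section
/- Let a, b be real numbers with 0 ≤ a ≤ 1/2 and b² ≤ a² + (1-a)², and set c := a(a-1). Then π²(2c(2 + b² + c) + b² + 1) - 16c(b² + c) ≤ 2π²(3c+1). -/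
open Real

theorem stmt_4 (a b : ℝ) (ha0 : 0 ≤ a) (ha : a ≤ 1 / 2)
    (hb : b ^ 2 ≤ a ^ 2 + (1 - a) ^ 2) (c : ℝ) (hc : c = a * (a - 1)) :
    π ^ 2 * (2 * c * (2 + b ^ 2 + c) + b ^ 2 + 1) - 16 * c * (b ^ 2 + c)
      ≤ 2 * π ^ 2 * (3 * c + 1) := by
  have hB : 0 ≤ 1 + 2 * c - b ^ 2 := by rw [hc]; linarith
  have hc0 : c ≤ 0 := by rw [hc]; nlinarith
  have hc1 : -(1 / 4) ≤ c := by rw [hc]; nlinarith [sq_nonneg (a - 1 / 2)]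
  have hp : 9 ≤ π ^ 2 := by nlinarith [Real.pi_gt_three]
  have h1 : 0 ≤ (π ^ 2 * (2 * c + 1) - 16 * c) * (1 + 2 * c - b ^ 2) := by
    apply mul_nonneg _ hB
    have : 0 ≤ π ^ 2 * (2 * c + 1) := mul_nonneg (by linarith) (by linarith)
    linarith
  have h2 : 0 ≤ (-2 * c) * (1 + 3 * c) * (π ^ 2 - 8) :=
    mul_nonneg (mul_nonneg (by linarith) (by linarith)) (by linarith)
  linarith
end

section
/- For every real number a with 0 ≤ a ≤ 1/2, one has a·P(a) ≤ 18·a·Q(a)·√(3 - 4a), where P(a) = 380800π²a⁵ + (504192 - 761600π²)a⁴ + (868000π² - 2869464)a³ - 480(665π² - 2682)a² - 8(44211 + 2450π²)a + 525(347 + 80π²) and Q(a) = 5600π²a⁴ + (74976 - 5600π²)a³ + 2(7700π² - 91173)a² + (72429 - 8400π²)a + 2100π². -/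
open Real

theorem aux_nonneg (p u : ℝ) (hp1 : 9.8695 ≤ p) (hp2 : p ≤ 9.8698) (hu0 : 0 ≤ u)
    (hu1 : u ≤ 0.7321) :
    0 ≤ ((-72800) * p + (733833)) * u ^ 0 + ((58800) * p + (-447099/2)) * u ^ 1 + ((85400) * p + (-2108013/2)) * u ^ 2 + ((23800) * p + (-1391367/2)) * u ^ 3 + ((55125/2) * p + (-1791651/8)) * u ^ 4 + ((34825) * p + (-36843)) * u ^ 5 + ((17675) * p + (-3939/2)) * u ^ 6 + ((8225/2) * p + (0)) * u ^ 7 + ((2975/8) * p + (0)) * u ^ 8 := by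
  have h2 : 0 ≤ (-72800) * p + 733833 := by linarith
  have h3 : 356700 ≤ 58800 * p + (-447099/2) := by linarith
  have h4 : -211250 ≤ 85400 * p + (-2108013/2) := by linarith
  have h5 : -460850 ≤ 23800 * p + (-1391367/2) := by linarith
  have h6 : 0 ≤ (55125/2) * p + (-1791651/8) := by linarith
  have h7 : 306800 ≤ 34825 * p + (-36843) := by linarith
  have h8 : 0 ≤ 17675 * p + (-3939/2) := by linarith
  have h9 : 0 ≤ (8225/2) * p := by linarith
  have h10 : 0 ≤ (2975/8) * p := by linarith
  have e3 := mul_le_mul_of_nonneg_right h3 hu0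
  have e4 := mul_le_mul_of_nonneg_right h4 (pow_nonneg hu0 2)
  have e5 := mul_le_mul_of_nonneg_right h5 (pow_nonneg hu0 3)
  have e6 := mul_nonneg h6 (pow_nonneg hu0 4)
  have e7 := mul_le_mul_of_nonneg_right h7 (pow_nonneg hu0 5)
  have e8 := mul_nonneg h8 (pow_nonneg hu0 6)
  have e9 := mul_nonneg h9 (pow_nonneg hu0 7)
  have e10 := mul_nonneg h10 (pow_nonneg hu0 8)
  have q : 0 ≤ 280000 - 211250 * u - 154050 * u ^ 2 := by nlinarith
  have q2 := mul_nonneg hu0 q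
  have q3 : 0 ≤ u * (u ^ 2 - 1 / 2) ^ 2 := mul_nonneg hu0 (sq_nonneg _)
  have q4 : 0 ≤ 356700 * u + -211250 * u ^ 2 + -460850 * u ^ 3 + 306800 * u ^ 5 := by
    nlinarith
  linarith

theorem aux_fact (p s a : ℝ) (h : a = (3 - s ^ 2) / 4) :
    18 * (5600 * p * a ^ 4 + (74976 - 5600 * p) * a ^ 3
        + 2 * (7700 * p - 91173) * a ^ 2
        + (72429 - 8400 * p) * a + 2100 * p) * s
      - (380800 * p * a ^ 5 + (504192 - 761600 * p) * a ^ 4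
        + (868000 * p - 2869464) * a ^ 3 - 480 * (665 * p - 2682) * a ^ 2
        - 8 * (44211 + 2450 * p) * a + 525 * (347 + 80 * p))
      = (s - 1) ^ 2 * (((-72800) * p + (733833)) * (s - 1) ^ 0 + ((58800) * p + (-447099/2)) * (s - 1) ^ 1 + ((85400) * p + (-2108013/2)) * (s - 1) ^ 2 + ((23800) * p + (-1391367/2)) * (s - 1) ^ 3 + ((55125/2) * p + (-1791651/8)) * (s - 1) ^ 4 + ((34825) * p + (-36843)) * (s - 1) ^ 5 + ((17675) * p + (-3939/2)) * (s - 1) ^ 6 + ((8225/2) * p + (0)) * (s - 1) ^ 7 + ((2975/8) * p + (0)) * (s - 1) ^ 8) := by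
  subst h
  ring

theorem stmt_10 (a : ℝ) (ha0 : 0 ≤ a) (ha : a ≤ 1 / 2) :
    a * (380800 * π ^ 2 * a ^ 5 + (504192 - 761600 * π ^ 2) * a ^ 4
        + (868000 * π ^ 2 - 2869464) * a ^ 3 - 480 * (665 * π ^ 2 - 2682) * a ^ 2
        - 8 * (44211 + 2450 * π ^ 2) * a + 525 * (347 + 80 * π ^ 2))
      ≤ 18 * a * (5600 * π ^ 2 * a ^ 4 + (74976 - 5600 * π ^ 2) * a ^ 3
        + 2 * (7700 * π ^ 2 - 91173) * a ^ 2
        + (72429 - 8400 * π ^ 2) * a + 2100 * π ^ 2) * Real.sqrt (3 - 4 * a) := by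
  have hs2 : Real.sqrt (3 - 4 * a) ^ 2 = 3 - 4 * a := Real.sq_sqrt (by linarith)
  have hs0 := Real.sqrt_nonneg (3 - 4 * a)
  set s := Real.sqrt (3 - 4 * a) with hs
  have hs1 : 1 ≤ s := by nlinarith
  have hs3 : s ≤ 1.7321 := by nlinarith
  have g1 := Real.pi_gt_d6
  have g2 := Real.pi_lt_d6
  have hp1 : 9.8695 ≤ π ^ 2 := by nlinarith
  have hp2 : π ^ 2 ≤ 9.8698 := by nlinarith
  have hH := aux_nonneg (π ^ 2) (s - 1) hp1 hp2 (by linarith) (by linarith)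
  have hF := aux_fact (π ^ 2) s a (by linarith)
  have hN := mul_nonneg ha0 (hF ▸ mul_nonneg (sq_nonneg (s - 1)) hH)
  linarith
end

section
/- For all real numbers a, b, γ with 1/2 ≤ a ≤ 1, 0 ≤ b ≤ 27/25, and 0 ≤ γ ≤ 1, one has (γ/6)(3a² + 3b² - 8a + 1) + (1/6)(8a - 3a² - 1) ≤ (π²/81)(a+1)(a²+3). -/
open Real

theorem stmt_11 (a b γ : ℝ) (ha1 : 1 / 2 ≤ a) (ha2 : a ≤ 1)
    (hb1 : 0 ≤ b) (hb2 : b ≤ 27 / 25) (hg1 : 0 ≤ γ) (hg2 : γ ≤ 1) :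
    γ / 6 * (3 * a ^ 2 + 3 * b ^ 2 - 8 * a + 1) + 1 / 6 * (8 * a - 3 * a ^ 2 - 1)
      ≤ π ^ 2 / 81 * (a + 1) * (a ^ 2 + 3) := by
  have hpi : (9.859 : ℝ) ≤ π ^ 2 := by nlinarith [Real.pi_gt_d2]
  have hP : 0 ≤ (a + 1) * (a ^ 2 + 3) := by positivity
  have hR : 9.859 / 81 * ((a + 1) * (a ^ 2 + 3)) ≤ π ^ 2 / 81 * (a + 1) * (a ^ 2 + 3) := by
    nlinarith [mul_le_mul_of_nonneg_right hpi hP]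
  have hb : b ^ 2 ≤ (27 / 25) ^ 2 := by gcongr
  have h1 : b ^ 2 / 2 ≤ 9.859 / 81 * ((a + 1) * (a ^ 2 + 3)) := by
    have : (1 / 2 + 1) * ((1 / 2) ^ 2 + 3) ≤ (a + 1) * (a ^ 2 + 3) := by gcongr
    linarith
  have h0 : 1 / 6 * (8 * a - 3 * a ^ 2 - 1) ≤ 9.859 / 81 * ((a + 1) * (a ^ 2 + 3)) := by
    nlinarith [mul_nonneg (by linarith : 0 ≤ a + 2) (sq_nonneg (a - 0.8)), sq_nonneg (a - 0.8),
      mul_nonneg (by linarith : 0 ≤ a) (sq_nonneg (a - 0.8)), sq_nonneg (a - 0.75),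
      mul_nonneg (by linarith : 0 ≤ a) (sq_nonneg (a - 0.75))]
  nlinarith [mul_le_mul_of_nonneg_left h1 hg1,
    mul_le_mul_of_nonneg_left h0 (by linarith : 0 ≤ 1 - γ)]
end

section
/- For all real numbers a, b with 1/2 ≤ a ≤ 7/10, 27/25 ≤ b, and (a+1)² + b² ≤ 4, one has D(a,b)·(a² - a + 1 + 3ab - (3/2)b + 2b²) ≤ 576π²b². -/
open Real

lemma poly_aux (a b : ℝ) (ha1 : 1 / 2 ≤ a) 
    (hb1 : 27 / 25 ≤ b) (hab : (a + 1) ^ 2 + b ^ 2 ≤ 4) :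
    (88.5 * (a ^ 2 + b ^ 2) + 118.5 - 147 * a)
        * (a ^ 2 - a + 1 + 3 * a * b - 3 / 2 * b + 2 * b ^ 2)
      ≤ 576 * b ^ 2 := by
  obtain ⟨x, rfl⟩ : ∃ x, a = 1/2 + x := ⟨a - 1/2, by ring⟩
  obtain ⟨y, rfl⟩ : ∃ y, b = 27/25 + y := ⟨b - 27/25, by ring⟩
  have hx : 0 ≤ x := by linarith
  have hy : 0 ≤ y := by linarith
  have h3 : 0 ≤ 4 - (1/2 + x + 1) ^ 2 - (27/25 + y) ^ 2 := by linarith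
  have hxy := mul_nonneg hx hy
  nlinarith [mul_nonneg hx h3, mul_nonneg hy h3, mul_nonneg hxy h3, mul_nonneg hxy hx, mul_nonneg hxy hy, mul_nonneg (sq_nonneg x) h3, mul_nonneg (sq_nonneg y) h3, mul_nonneg hxy hxy, mul_nonneg hxy (sq_nonneg x), mul_nonneg hxy (sq_nonneg y), pow_nonneg hx 3, pow_nonneg hy 3, pow_nonneg hx 4, pow_nonneg hy 4]

theorem stmt_12 (a b : ℝ) (ha1 : 1 / 2 ≤ a) (ha2 : a ≤ 7 / 10)
    (hb1 : 27 / 25 ≤ b) (hab : (a + 1) ^ 2 + b ^ 2 ≤ 4) :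
    (64 * π ^ 2 * (a ^ 2 + b ^ 2 + 3) + 243 * (a ^ 2 + b ^ 2 - 6 * a - 3))
        * (a ^ 2 - a + 1 + 3 * a * b - 3 / 2 * b + 2 * b ^ 2)
      ≤ 576 * π ^ 2 * b ^ 2 := by
  have hP : 24.5 * π ^ 2 ≤ 243 := by
    have := pi_lt_d4
    have := pi_pos
    nlinarith
  have hs : 0 ≤ 6 * a + 3 - a ^ 2 - b ^ 2 := by nlinarith
  have hq : 0 ≤ a ^ 2 - a + 1 + 3 * a * b - 3 / 2 * b + 2 * b ^ 2 := by
    nlinarith [sq_nonneg (a - 1/2), mul_nonneg (sub_nonneg.2 ha1) (sub_nonneg.2 hb1)]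
  have h1 : 64 * π ^ 2 * (a ^ 2 + b ^ 2 + 3) + 243 * (a ^ 2 + b ^ 2 - 6 * a - 3)
      ≤ π ^ 2 * (88.5 * (a ^ 2 + b ^ 2) + 118.5 - 147 * a) := by
    nlinarith [mul_nonneg (sub_nonneg.2 hP) hs]
  have h2 := mul_le_mul_of_nonneg_right h1 hq
  have h3 := mul_le_mul_of_nonneg_left (poly_aux a b ha1 hb1 hab) (sq_nonneg π)
  linarith
end

section
/- For all real numbers a, b in the admissible acute region R := {(a,b) : 0 ≤ a ≤ 1/2, a² + b² ≥ 1, (a+1)² + b² ≤ 4, b > 0}, one has D(a,b)·(a + b) ≤ 384π²b. -/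
open Real

theorem stmt_14 (a b : ℝ) (ha0 : 0 ≤ a) (ha : a ≤ 1 / 2)
    (hacute : 1 ≤ a ^ 2 + b ^ 2) (hlong : (a + 1) ^ 2 + b ^ 2 ≤ 4) (hb : 0 < b) :
    (64 * π ^ 2 * (a ^ 2 + b ^ 2 + 3) + 243 * (a ^ 2 + b ^ 2 - 6 * a - 3)) * (a + b)
      ≤ 384 * π ^ 2 * b := by
  have h1 := Real.pi_gt_d4
  have h2 := Real.pi_lt_d4
  obtain ⟨P, hP⟩ : ∃ P, P = 64 * π ^ 2 := ⟨_, rfl⟩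
  have hP1 : 631 < P := by rw [hP]; nlinarith
  have hP2 : P < 632 := by rw [hP]; nlinarith
  have e : 384 * π ^ 2 * b = 6 * P * b := by rw [hP]; ring
  rw [e, ← hP]
  clear e hP
  obtain ⟨t, ht⟩ : ∃ t, t = 3 - 2 * a - (a ^ 2 + b ^ 2) := ⟨_, rfl⟩
  have ht0 : 0 ≤ t := by rw [ht]; nlinarith
  have hab : 0 ≤ a * b := by positivity
  have hq : 1 ≤ a + b := by nlinarith
  have key : 2 * a * (3 * P - (P + 972) * (a + b)) ≤ t * (P + 243) * (a + b) := by
    rcases le_total 1.19 (a + b) with h | h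
    · have : 3 * P - (P + 972) * (a + b) ≤ 0 := by nlinarith
      have h3 : 2 * a * (3 * P - (P + 972) * (a + b)) ≤ 0 :=
        mul_nonpos_of_nonneg_of_nonpos (by linarith) this
      have : 0 ≤ t * (P + 243) * (a + b) :=
        mul_nonneg (mul_nonneg ht0 (by linarith)) (by linarith)
      linarith
    · have h3 : 3 * P - (P + 972) * (a + b) ≤ 292 := by nlinarith
      have h4 : 2 * a * (3 * P - (P + 972) * (a + b)) ≤ 2 * a * 292 :=
        mul_le_mul_of_nonneg_left h3 (by linarith)
      have h5 : 0.5 ≤ t := by rw [ht]; nlinarith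
      have h6 : 0.5 * 874 ≤ t * (P + 243) := by nlinarith
      nlinarith
  have hs : a ^ 2 + b ^ 2 = 3 - 2 * a - t := by rw [ht]; ring
  rw [hs]
  linarith
end

section
/- For all real numbers a, b in the admissible acute region R := {(a,b) : 0 ≤ a ≤ 1/2, a² + b² ≥ 1, (a+1)² + b² ≤ 4, b > 0}, one has D(a,b)·( a(a² - a + 1) + (1/2 - a)(a² + 1) ) ≤ 288π²b²·(3/8 - a/12). -/
open Real

theorem stmt_15 (a b : ℝ) (ha0 : 0 ≤ a) (ha : a ≤ 1 / 2)
    (hacute : 1 ≤ a ^ 2 + b ^ 2) (hlong : (a + 1) ^ 2 + b ^ 2 ≤ 4) (hb : 0 < b) :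
    (64 * π ^ 2 * (a ^ 2 + b ^ 2 + 3) + 243 * (a ^ 2 + b ^ 2 - 6 * a - 3))
        * (a * (a ^ 2 - a + 1) + (1 / 2 - a) * (a ^ 2 + 1))
      ≤ 288 * π ^ 2 * b ^ 2 * (3 / 8 - a / 12) := by
  have hl : (9 : ℝ) ≤ π ^ 2 := by nlinarith [Real.pi_gt_three]
  have hu : π ^ 2 ≤ 10 := by nlinarith [Real.pi_gt_three, Real.pi_lt_d2]
  generalize π ^ 2 = P at *
  have h1 : 0 ≤ 12 * P * (9 - 2 * a) - (64 * P + 243) * (1 - a ^ 2) / 2 := by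
    have e1 : 0 ≤ P * (1 / 2 - a) := mul_nonneg (by linarith) (by linarith)
    have e2 : 0 ≤ P * a ^ 2 := mul_nonneg (by linarith) (sq_nonneg a)
    nlinarith [sq_nonneg a]
  have h2 : 0 ≤ 243 - 20 * P + (729 - 24 * P) * a := by
    have e1 : 0 ≤ (729 - 24 * P) * a := mul_nonneg (by linarith) ha0
    linarith
  have h3 : 0 ≤ 1 - a ^ 2 := by nlinarith
  have h4 : 0 ≤ a ^ 2 + b ^ 2 - 1 := by linarith
  have h5 := mul_nonneg h4 h1
  have h6 := mul_nonneg h3 h2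
  nlinarith [h5, h6]
end

section
/- For all real numbers a, b in the admissible acute region R := {(a,b) : 0 ≤ a ≤ 1/2, a² + b² ≥ 1, (a+1)² + b² ≤ 4, b > 0}, one has D(a,b)·(a² + 3 + 3ab + 2b²) ≤ 1152π²b². -/
open Real

theorem stmt_16 (a b : ℝ) (ha0 : 0 ≤ a) (ha : a ≤ 1 / 2)
    (hacute : 1 ≤ a ^ 2 + b ^ 2) (hlong : (a + 1) ^ 2 + b ^ 2 ≤ 4) (hb : 0 < b) :
    (64 * π ^ 2 * (a ^ 2 + b ^ 2 + 3) + 243 * (a ^ 2 + b ^ 2 - 6 * a - 3))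
        * (a ^ 2 + 3 + 3 * a * b + 2 * b ^ 2)
      ≤ 1152 * π ^ 2 * b ^ 2 := by
  have hQ : 0 < a ^ 2 + 3 + 3 * a * b + 2 * b ^ 2 := by positivity
  have hB : (a ^ 2 + b ^ 2 - 6 * a - 3) * (a ^ 2 + 3 + 3 * a * b + 2 * b ^ 2) ≤ 0 :=
    mul_nonpos_of_nonpos_of_nonneg (by nlinarith) hQ.le
  have hp : 64 * π ^ 2 ≤ 640 := by nlinarith [Real.pi_lt_d2, Real.pi_gt_three]
  have hp0 : 0 ≤ 64 * π ^ 2 := by positivity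
  have key : 640 * ((a ^ 2 + b ^ 2 + 3) * (a ^ 2 + 3 + 3 * a * b + 2 * b ^ 2) - 18 * b ^ 2)
      + 243 * ((a ^ 2 + b ^ 2 - 6 * a - 3) * (a ^ 2 + 3 + 3 * a * b + 2 * b ^ 2)) ≤ 0 := by
    obtain ⟨s, hs⟩ : ∃ s, s = a ^ 2 + b ^ 2 := ⟨_, rfl⟩
    have hbs : b ^ 2 = s - a ^ 2 := by linarith
    have hs1 : 0 ≤ s - 1 := by linarith
    have hs2 : 0 ≤ 3 - 2 * a - s := by nlinarith
    have hL : 0 ≤ 883 * s - 1458 * a + 1191 := by linarith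
    have hab : 3 * a * b ≤ a * (s - a ^ 2 + 9 / 4) := by
      rw [← hbs]
      nlinarith [mul_nonneg ha0 (sq_nonneg (b - 3 / 2))]
    have ha2 : 0 ≤ 1 / 2 - a := by linarith
    have h1 := mul_nonneg ha0 ha2
    have h2 := mul_nonneg (mul_nonneg ha0 ha0) ha2
    have h3 := mul_nonneg (mul_nonneg ha0 ha2) ha2
    have h4 := mul_nonneg (mul_nonneg (mul_nonneg ha0 ha0) ha0) ha2
    have h5 := mul_nonneg (mul_nonneg (mul_nonneg ha0 ha0) ha2) ha2
    -- values of the convex quadratic at the two endpoints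
    have e1 : (883 * 1 - 1458 * a + 1191) * ((2 + a) * 1 - a ^ 3 - a ^ 2 + 9 / 4 * a + 3)
        - 11520 * (1 - a ^ 2) ≤ 0 := by nlinarith
    have e2 : (883 * (3 - 2 * a) - 1458 * a + 1191)
        * ((2 + a) * (3 - 2 * a) - a ^ 3 - a ^ 2 + 9 / 4 * a + 3)
        - 11520 * (3 - 2 * a - a ^ 2) ≤ 0 := by nlinarith
    have g : (883 * s - 1458 * a + 1191) * ((2 + a) * s - a ^ 3 - a ^ 2 + 9 / 4 * a + 3)
        - 11520 * (s - a ^ 2) ≤ 0 := by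
      have k0 := mul_nonneg (mul_nonneg hs1 hs2)
        (mul_nonneg (by linarith : (0:ℝ) ≤ 2 + a) (by linarith : (0:ℝ) ≤ 2 - 2 * a))
      have k1 := mul_nonneg hs2 (neg_nonneg.2 e1)
      have k2 := mul_nonneg hs1 (neg_nonneg.2 e2)
      have : 0 ≤ (2 - 2 * a) * -((883 * s - 1458 * a + 1191)
          * ((2 + a) * s - a ^ 3 - a ^ 2 + 9 / 4 * a + 3) - 11520 * (s - a ^ 2)) := by
        linear_combination k1 + k2 + 883 * k0
      have := nonneg_of_mul_nonneg_right this (by linarith)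
      linarith
    have hm := mul_le_mul_of_nonneg_left hab hL
    rw [← hs, hbs]
    linear_combination g + hm
  rcases le_total ((a ^ 2 + b ^ 2 + 3) * (a ^ 2 + 3 + 3 * a * b + 2 * b ^ 2) - 18 * b ^ 2) 0 with h | h
  · nlinarith [mul_nonneg hp0 (neg_nonneg.2 h)]
  · nlinarith [mul_nonneg (sub_nonneg.2 hp) h]
end

section
/- For all real numbers a, b in the admissible acute region R := {(a,b) : 0 ≤ a ≤ 1/2, a² + b² ≥ 1, (a+1)² + b² ≤ 4, b > 0}, one has (a + b - 1)·( D(a,b)·(a² + 3 - ab) - 384π²b² ) + (8/7)·(√3 - b)·( D(a,b)·(a² + 1 - ab) - 216π²b² ) ≤ 0. -/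
open Real

/-- The quotient `(F(a,b) - F(0,b)) / a`, with `p` for `π²` and `s` for `√3`. -/
noncomputable def auxG (p s a b : ℝ) : ℝ :=
  (3 * (64 * p * (b ^ 2 + 3) + 243 * (b ^ 2 - 3)) - 384 * p * b ^ 2)
  + (a + b - 1) * (((64 * p + 243) * a - 1458) * (a ^ 2 + 3 - a * b)
      + (64 * p * (b ^ 2 + 3) + 243 * (b ^ 2 - 3)) * (a - b))
  + 8 / 7 * (s - b) * (((64 * p + 243) * a - 1458) * (a ^ 2 + 1 - a * b)
      + (64 * p * (b ^ 2 + 3) + 243 * (b ^ 2 - 3)) * (a - b))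

theorem affine_nonpos (c d l u x : ℝ) (hl : l ≤ x) (hu : x ≤ u)
    (h1 : c * l + d ≤ 0) (h2 : c * u + d ≤ 0) : c * x + d ≤ 0 := by
  rcases le_total 0 c with h | h
  · nlinarith [mul_le_mul_of_nonneg_left hu h]
  · nlinarith [mul_le_mul_of_nonpos_left hl h]

theorem auxG_affine (p s a b p0 p1 s0 s1 : ℝ) (hp0 : p0 ≤ p) (hp1 : p ≤ p1)
    (hs0 : s0 ≤ s) (hs1 : s ≤ s1)
    (h00 : auxG p0 s0 a b ≤ 0) (h01 : auxG p0 s1 a b ≤ 0)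
    (h10 : auxG p1 s0 a b ≤ 0) (h11 : auxG p1 s1 a b ≤ 0) : auxG p s a b ≤ 0 := by
  have hs : ∀ q, auxG q s0 a b ≤ 0 → auxG q s1 a b ≤ 0 → auxG q s a b ≤ 0 := by
    intro q h0 h1
    have e : ∀ x, auxG q x a b = (auxG q 1 a b - auxG q 0 a b) * x + auxG q 0 a b := by
      intro x; unfold auxG; ring
    rw [e]; rw [e] at h0 h1
    exact affine_nonpos _ _ _ _ _ hs0 hs1 h0 h1
  have h0 := hs p0 h00 h01
  have h1 := hs p1 h10 h11
  have e : ∀ x, auxG x s a b = (auxG 1 s a b - auxG 0 s a b) * x + auxG 0 s a b := by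
    intro x; unfold auxG; ring
  rw [e]; rw [e] at h0 h1
  exact affine_nonpos _ _ _ _ _ hp0 hp1 h0 h1

theorem auxG_box (p s a b : ℝ) (hp0 : 9.869 ≤ p) (hp1 : p ≤ 9.87)
    (hs0 : 1.732 ≤ s) (hs1 : s ≤ 1.7321) (ha0 : 0 ≤ a) (ha : a ≤ 1 / 2)
    (hb0 : 0.95 ≤ b) (hb : b ≤ 1.7321) : auxG p s a b ≤ 0 := by
  have x0 := mul_nonneg ha0 (sub_nonneg.2 ha)
  have x1 := mul_nonneg ha0 (sub_nonneg.2 hb0)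
  have x2 := mul_nonneg (sub_nonneg.2 ha) (sub_nonneg.2 hb0)
  have x3 := mul_nonneg (sub_nonneg.2 hb) (sub_nonneg.2 hb0)
  apply auxG_affine p s a b _ _ _ _ hp0 hp1 hs0 hs1 <;> unfold auxG <;>
  nlinarith [mul_nonneg x0 (sub_nonneg.2 hb0), mul_nonneg x1 (sub_nonneg.2 hb0),
    mul_nonneg x2 (sub_nonneg.2 hb0), mul_nonneg x3 (sub_nonneg.2 hb0), mul_nonneg x3 ha0,
    mul_nonneg x0 x0, mul_nonneg x0 x1, mul_nonneg x0 x2, mul_nonneg x1 x1, mul_nonneg x1 x2,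
    mul_nonneg x0 ha0, mul_nonneg x3 x0, mul_nonneg x3 x1, mul_nonneg x3 x3]

theorem auxG_box2 (p s a b : ℝ) (hp0 : 9.869 ≤ p) (hp1 : p ≤ 9.87)
    (hs0 : 1.732 ≤ s) (hs1 : s ≤ 1.7321) (ha0 : 0.31 ≤ a) (ha : a ≤ 1 / 2)
    (hb0 : 0.866 ≤ b) (hb : b ≤ 0.95) : auxG p s a b ≤ 0 := by
  have x0 := mul_nonneg (sub_nonneg.2 ha0) (sub_nonneg.2 ha)
  have x1 := mul_nonneg (sub_nonneg.2 ha0) (sub_nonneg.2 hb0)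
  have x2 := mul_nonneg (sub_nonneg.2 ha) (sub_nonneg.2 hb0)
  have x3 := mul_nonneg (sub_nonneg.2 hb) (sub_nonneg.2 hb0)
  apply auxG_affine p s a b _ _ _ _ hp0 hp1 hs0 hs1 <;> unfold auxG <;>
  nlinarith [mul_nonneg x0 (sub_nonneg.2 hb0), mul_nonneg x1 (sub_nonneg.2 hb0),
    mul_nonneg x2 (sub_nonneg.2 hb0), mul_nonneg x3 (sub_nonneg.2 hb0),
    mul_nonneg x3 (sub_nonneg.2 ha0),
    mul_nonneg x0 x0, mul_nonneg x0 x1, mul_nonneg x0 x2, mul_nonneg x1 x1, mul_nonneg x1 x2,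
    mul_nonneg x0 (sub_nonneg.2 ha0), mul_nonneg x3 x0, mul_nonneg x3 x1, mul_nonneg x3 x3]

theorem auxQ (p s b : ℝ) (hp0 : 9.869 ≤ p) (hp1 : p ≤ 9.87)
    (hs0 : 1.732 ≤ s) (hs1 : s ≤ 1.7321) (hb0 : 0.866 ≤ b) (hb : b ≤ 1.7321) :
    (b - 1) * (s + b) * (192 * p - 729)
      + 8 / 7 * ((64 * p * (b ^ 2 + 3) + 243 * (b ^ 2 - 3)) - 216 * p * b ^ 2) ≤ 0 := by
  have hs : ∀ q, 9.869 ≤ q → q ≤ 9.87 → (b - 1) * (b + 1.73205) * (192 * q - 729)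
      + 8 / 7 * ((64 * q * (b ^ 2 + 3) + 243 * (b ^ 2 - 3)) - 216 * q * b ^ 2) ≤ -5 := by
    intro q h0 h1
    have := affine_nonpos ((b - 1) * (b + 1.73205) * 192 + 8 / 7 * (64 * (b ^ 2 + 3) - 216 * b ^ 2))
      ((b - 1) * (b + 1.73205) * (-729) + 8 / 7 * (243 * (b ^ 2 - 3)) + 5) _ _ q h0 h1
      (by nlinarith [sq_nonneg (b - 1.58)]) (by nlinarith [sq_nonneg (b - 1.58)])
    linarith
  have h := hs p hp0 hp1
  have h2 : (b - 1) * (192 * p - 729) * (s - 1.73205) ≤ 1 := by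
    have : (b - 1) * (192 * p - 729) ≤ 1000 := by nlinarith
    have h3 : -1000 ≤ (b - 1) * (192 * p - 729) := by nlinarith
    nlinarith
  nlinarith

theorem stmt_19 (a b : ℝ) (ha0 : 0 ≤ a) (ha : a ≤ 1 / 2)
    (hacute : 1 ≤ a ^ 2 + b ^ 2) (hlong : (a + 1) ^ 2 + b ^ 2 ≤ 4) (hb : 0 < b) :
    (a + b - 1) *
        ((64 * π ^ 2 * (a ^ 2 + b ^ 2 + 3) + 243 * (a ^ 2 + b ^ 2 - 6 * a - 3))
            * (a ^ 2 + 3 - a * b) - 384 * π ^ 2 * b ^ 2)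
      + 8 / 7 * (Real.sqrt 3 - b) *
        ((64 * π ^ 2 * (a ^ 2 + b ^ 2 + 3) + 243 * (a ^ 2 + b ^ 2 - 6 * a - 3))
            * (a ^ 2 + 1 - a * b) - 216 * π ^ 2 * b ^ 2) ≤ 0 := by
  have hp0 : 9.869 ≤ π ^ 2 := by nlinarith [Real.pi_gt_d6]
  have hp1 : π ^ 2 ≤ 9.87 := by nlinarith [Real.pi_lt_d6, Real.pi_pos]
  have hs0 : 1.732 ≤ √3 := Real.le_sqrt_of_sq_le (by norm_num)
  have hs1 : √3 ≤ 1.7321 := Real.sqrt_le_iff.2 (by norm_num)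
  have hss : √3 ^ 2 = 3 := Real.sq_sqrt (by norm_num)
  have hbs : b ≤ √3 := Real.le_sqrt_of_sq_le (by nlinarith)
  have hb0 : 0.866 ≤ b := by nlinarith
  have hQ := auxQ _ _ b hp0 hp1 hs0 hs1 hb0 (hbs.trans hs1)
  have hG : auxG (π ^ 2) √3 a b ≤ 0 := by
    rcases le_total 0.95 b with h | h
    · exact auxG_box _ _ a b hp0 hp1 hs0 hs1 ha0 ha h (hbs.trans hs1)
    · exact auxG_box2 _ _ a b hp0 hp1 hs0 hs1 (by nlinarith) ha hb0 h
  have k1 := mul_nonpos_of_nonneg_of_nonpos ha0 hG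
  have k2 := mul_nonpos_of_nonneg_of_nonpos (sub_nonneg.2 hbs) hQ
  refine le_trans (le_of_eq ?_) (add_nonpos k1 k2)
  unfold auxG
  generalize π ^ 2 = p
  linear_combination (-(b - 1) * (192 * p - 729)) * hss
end
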